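/- Let k be a field, let Λ be a finite partially ordered set, and let A = k[Λ] be its incidence algebra. Suppose λ, λ' ∈ Λ are such that the closed interval {γ ∈ Λ : λ ≥ γ ≥ λ'} is a simple loop, i.e., it equals {λ, a, b, λ'} where a and b are incomparable, λ covers both a and b, and both a and b cover λ'. Then Ext^2_A(M_λ, M_{λ'}) ≅ k as k-vector spaces, where M_λ and M_{λ'} are the one-dimensional simple right A-modules associated to λ and λ'. -/

import Mathlib

open CategoryTheory OrderDual

variable (k : Type u) [Field k] (Λ : Type u) [PartialOrder Λ] [Fintype Λ] [DecidableEq Λ]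
  [LocallyFiniteOrder Λ]

/-- Evaluation at `(λ, λ)` as a ring homomorphism from the opposite of the incidence
algebra `k[Λ]` to `k`. -/
def evalHom (l : Λ) : (IncidenceAlgebra k Λᵒᵈ)ᵐᵒᵖ →+* k where
  toFun f := f.unop (toDual l) (toDual l)
  map_one' := by simp
  map_mul' f g := by
    simp [IncidenceAlgebra.mul_apply, mul_comm]
  map_zero' := by simp
  map_add' f g := by simp

/-- The simple right `k[Λ]`-module `M_λ` attached to `λ ∈ Λ`: the underlying space is `k`,
the basis element `e_{λλ}` acts as the identity and all other basis elements act as zero;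
equivalently, `f ∈ k[Λ]` acts on `M_λ` by multiplication by `f λ λ`. -/
def SimpleM (l : Λ) : Type u := k

instance (l : Λ) : AddCommGroup (SimpleM k Λ l) := inferInstanceAs (AddCommGroup k)

instance (l : Λ) : Module k (SimpleM k Λ l) := inferInstanceAs (Module k k)

instance (l : Λ) : Module (IncidenceAlgebra k Λᵒᵈ)ᵐᵒᵖ (SimpleM k Λ l) :=
  Module.compHom k (evalHom k Λ l)

/-- The closed interval `{γ : λ ≥ γ ≥ λ′}` is a *simple loop*: it equals `{λ, a, b, λ′}`
where `a` and `b` are incomparable, `λ` covers both `a` and `b`, and both `a` and `b`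
cover `λ′`. -/
def IsSimpleLoop (l l' : Λ) : Prop :=
  ∃ a b : Λ, ¬ a ≤ b ∧ ¬ b ≤ a ∧ a ⋖ l ∧ b ⋖ l ∧ l' ⋖ a ∧ l' ⋖ b ∧
    Set.Icc l' l = {l, a, b, l'}

section gen

open CategoryTheory Limits
variable {C : Type*} [Category* C] [Abelian C]

noncomputable def resOfComplex (K : ChainComplex C ℕ) (hp : ∀ n, Projective (K.X n)) {Z : C}
    (p : K.X 0 ⟶ Z) [Epi p] (w : K.d 1 0 ≫ p = 0) (ex : (ShortComplex.mk (K.d 1 0) p w).Exact)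
    (exs : ∀ n, K.ExactAt (n + 1)) : ProjectiveResolution Z where
  complex := K
  projective := hp
  π := (ChainComplex.toSingle₀Equiv _ _).symm ⟨p, w⟩
  quasiIso := ⟨fun n => by
    cases n
    · rw [ChainComplex.quasiIsoAt₀_iff, ShortComplex.quasiIso_iff_of_zeros']
      · refine (ShortComplex.exact_and_epi_g_iff_of_iso ?_).2
          ⟨ex, by dsimp; infer_instance⟩
        exact ShortComplex.isoMk (Iso.refl _) (Iso.refl _) (Iso.refl _)
          ((Category.id_comp _).trans (Category.comp_id _).symm)
          ((Category.id_comp _).trans (Eq.trans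
            (ChainComplex.toSingle₀Equiv_symm_apply_f_zero (C := K) p w).symm
              (Category.comp_id _).symm))
      · exact K.shape _ _ (by simp)
      all_goals rfl
    · rw [quasiIsoAt_iff_exactAt']
      · apply exs
      · apply ChainComplex.exactAt_succ_single_obj⟩

variable {k : Type*} [Ring k] [Linear k C]

lemma homology_two (K : ChainComplex C ℕ) (h1 : K.ExactAt 1) (h2 : K.ExactAt 2) (N : C)
    (hN : ∀ f : K.X 1 ⟶ N, f = 0) : 
    Nonempty ((K.linearYonedaObj k N).homology 2 ≃ₗ[k] (kernel (K.d 1 0) ⟶ N)) := by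
  rw [HomologicalComplex.exactAt_iff' _ 2 1 0 (by simp) (by simp)] at h1
  rw [HomologicalComplex.exactAt_iff' _ 3 2 1 (by simp) (by simp)] at h2
  let L := K.linearYonedaObj k N
  have hd : L.d 1 2 = 0 := by
    refine ModuleCat.hom_ext (LinearMap.ext fun f => ?_)
    have := hN f
    rw [this]
    exact (map_zero _).trans rfl
  let e1 : L.cycles 2 ≅ L.homology 2 := L.isoHomologyπ 1 2 (by simp) hd
  let q : K.X 2 ⟶ kernel (K.d 1 0) := kernel.lift _ (K.d 2 1) (by simp)
  have hq : Epi q := h1.epi_kernelLift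
  let S := L.sc' 1 2 3
  let e2 : L.cycles 2 ≅ S.cycles := L.cyclesIsoSc' 1 2 3 (by simp) (by simp)
  let e3 := S.moduleCatCyclesIso
  let φ : (kernel (K.d 1 0) ⟶ N) →ₗ[k] (LinearMap.ker S.g.hom) :=
    LinearMap.codRestrict _ (Linear.leftComp k N q) (fun f => by
      change K.d 3 2 ≫ q ≫ f = 0
      have : K.d 3 2 ≫ q = 0 := by
        rw [← cancel_mono (kernel.ι _)]; simp [q]
      rw [← Category.assoc, this, zero_comp])
  have hφ : Function.Bijective φ := by
    constructor
    · intro f g h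
      have : q ≫ f = q ≫ g := congrArg Subtype.val h
      exact (cancel_epi q).1 this
    · rintro ⟨f, hf⟩
      change K.X 2 ⟶ N at f
      change K.d 3 2 ≫ f = 0 at hf
      have hf' : kernel.ι q ≫ f = 0 := by
        let r : K.X 3 ⟶ kernel (K.d 2 1) := kernel.lift _ (K.d 3 2) (by simp)
        have : Epi r := h2.epi_kernelLift
        let s : kernel q ⟶ kernel (K.d 2 1) := kernel.lift _ (kernel.ι q) (by
          have : K.d 2 1 = q ≫ kernel.ι _ := by simp [q]
          rw [this]; simp)
        have h3 : kernel.ι (K.d 2 1) ≫ f = 0 := by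
          rw [← cancel_epi r]; simp [r, hf]
        have : kernel.ι q = s ≫ kernel.ι (K.d 2 1) := by simp [s]
        rw [this, Category.assoc, h3, comp_zero]
      refine ⟨Abelian.epiDesc q f hf', Subtype.ext ?_⟩
      exact Abelian.comp_epiDesc q f hf'
  exact ⟨(e1.symm ≪≫ e2 ≪≫ e3).toLinearEquiv.trans (LinearEquiv.ofBijective φ hφ).symm⟩

variable [EnoughProjectives C]

lemma proj_d_comp {X Y : C} (f : X ⟶ Y) : Projective.d f ≫ f = 0 :=
  (Category.assoc _ _ _).trans (by rw [kernel.condition]; exact comp_zero)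

noncomputable def splComplex {P1 P0 : C} (d : P1 ⟶ P0) : ChainComplex C ℕ :=
  ChainComplex.mk' P0 P1 d (fun f => ⟨Projective.syzygies f, Projective.d f, proj_d_comp f⟩)

lemma splComplex_d_1_0 {P1 P0 : C} (d : P1 ⟶ P0) : (splComplex d).d 1 0 = d := 
  ChainComplex.mk'_d_1_0 ..

lemma splComplex_exact {P1 P0 : C} (d : P1 ⟶ P0) (n : ℕ) :
    (splComplex d).ExactAt (n + 1) := by
  rw [HomologicalComplex.exactAt_iff' _ (n + 2) (n + 1) n (by simp) (by simp)]
  refine ShortComplex.exact_of_iso ?_ (exact_d_f ((splComplex d).d (n + 1) n))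
  refine ShortComplex.isoMk (ChainComplex.mk'XIso P0 P1 d (fun f => ⟨Projective.syzygies f, Projective.d f, proj_d_comp f⟩) n).symm (Iso.refl _) (Iso.refl _) ?_ ?_
  · have := ChainComplex.mk'_d P0 P1 d (fun f => ⟨Projective.syzygies f, Projective.d f, proj_d_comp f⟩) n
    refine Eq.trans ?_ (Category.comp_id _).symm
    refine (Iso.inv_comp_eq _).2 this
  · exact (Category.id_comp _).trans (Category.comp_id _).symm

lemma splComplex_projective {P1 P0 : C} (d : P1 ⟶ P0) [Projective P0] [Projective P1] (n : ℕ) :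
    Projective ((splComplex d).X n) := by
  obtain (_ | _ | n) := n
  · assumption
  · assumption
  · refine Projective.of_iso (ChainComplex.mk'XIso P0 P1 d (fun f => ⟨Projective.syzygies f, Projective.d f, proj_d_comp f⟩) n).symm ?_
    exact inferInstanceAs (Projective (Projective.syzygies _))

noncomputable def splRes {P1 P0 Z : C} (d : P1 ⟶ P0) (p : P0 ⟶ Z) [Projective P0] [Projective P1]
    [Epi p] (w : d ≫ p = 0) (ex : (ShortComplex.mk d p w).Exact) : ProjectiveResolution Z :=
  @resOfComplex C _ _ (splComplex d) (splComplex_projective d) Z p ‹_›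
    ((congrArg (fun x : P1 ⟶ P0 => x ≫ p) (splComplex_d_1_0 d)).trans w) (by
      refine ShortComplex.exact_of_iso ?_ ex
      refine ShortComplex.isoMk (Iso.refl P1) (Iso.refl P0) (Iso.refl Z) ?_ ?_
      · refine (Category.id_comp _).trans (Eq.trans ?_ (Category.comp_id _).symm)
        exact splComplex_d_1_0 d
      · exact (Category.id_comp _).trans (Category.comp_id _).symm)
    (splComplex_exact d)

lemma ext_two_gen {P1 P0 Z : C} (d : P1 ⟶ P0) (p : P0 ⟶ Z) [Projective P0] [Projective P1]
    [Epi p] (w : d ≫ p = 0) (ex : (ShortComplex.mk d p w).Exact) (N : C)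
    (hN : ∀ f : P1 ⟶ N, f = 0) :
    Nonempty (((Ext k C 2).obj (Opposite.op Z)).obj N ≃ₗ[k] (kernel d ⟶ N)) := by
  obtain ⟨e⟩ := homology_two (k := k) (splComplex d) (splComplex_exact d 0) (splComplex_exact d 1) N hN
  have h := splComplex_d_1_0 d
  have key : ∀ d' : P1 ⟶ P0, d' = d → Nonempty ((kernel d' ⟶ N) ≃ₗ[k] (kernel d ⟶ N)) := by
    rintro _ rfl
    exact ⟨LinearEquiv.refl k _⟩
  obtain ⟨e2⟩ := key _ h
  exact ⟨((splRes d p w ex).isoExt 2 N).toLinearEquiv.trans (e.trans e2)⟩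

end gen

theorem mul_apply_univ (f g : IncidenceAlgebra k Λᵒᵈ) (x y : Λ) :
    (f * g) (toDual x) (toDual y) =
      ∑ z : Λ, f (toDual x) (toDual z) * g (toDual z) (toDual y) := by
  rw [IncidenceAlgebra.mul_apply]
  refine Finset.sum_subset (s₂ := (Finset.univ : Finset Λᵒᵈ)) (Finset.subset_univ _) ?_
  intro z _ hz
  rw [Finset.mem_Icc, not_and_or] at hz
  rcases hz with hz | hz
  · rw [IncidenceAlgebra.apply_eq_zero_of_not_le hz, zero_mul]
  · rw [IncidenceAlgebra.apply_eq_zero_of_not_le hz, mul_zero]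

/-- All square matrices indexed by `Λ`, as a right module over the incidence algebra. -/
def Big : Type u := Λ → Λ → k

instance : AddCommGroup (Big k Λ) := inferInstanceAs (AddCommGroup (Λ → Λ → k))

instance : SMul (IncidenceAlgebra k Λᵒᵈ)ᵐᵒᵖ (Big k Λ) :=
  ⟨fun g F c y => ∑ z : Λ, F c z * g.unop (toDual z) (toDual y)⟩

theorem big_smul_apply (g : (IncidenceAlgebra k Λᵒᵈ)ᵐᵒᵖ) (F : Big k Λ) (c y : Λ) :
    (g • F) c y = ∑ z : Λ, F c z * g.unop (toDual z) (toDual y) := rfl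

theorem big_add_apply (F G : Big k Λ) (c y : Λ) : (F + G) c y = F c y + G c y := rfl
theorem big_zero_apply (c y : Λ) : (0 : Big k Λ) c y = 0 := rfl

theorem big_ext {F G : Big k Λ} (h : ∀ c y, F c y = G c y) : F = G :=
  funext fun c => funext fun y => h c y

instance : Module (IncidenceAlgebra k Λᵒᵈ)ᵐᵒᵖ (Big k Λ) where
  one_smul F := by
    refine big_ext k Λ fun c y => ?_
    simp [big_smul_apply]
  mul_smul g h F := by
    refine big_ext k Λ fun c y => ?_
    simp only [big_smul_apply, MulOpposite.unop_mul, mul_apply_univ, Finset.mul_sum,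
      Finset.sum_mul]
    rw [Finset.sum_comm]
    simp only [mul_assoc]
  smul_zero g := by
    refine big_ext k Λ fun c y => ?_
    simp [big_smul_apply, big_zero_apply]
  smul_add g F G := by
    refine big_ext k Λ fun c y => ?_
    simp [big_smul_apply, big_add_apply, add_mul, Finset.sum_add_distrib]
  add_smul g h F := by
    refine big_ext k Λ fun c y => ?_
    simp [big_smul_apply, big_add_apply, mul_add, Finset.sum_add_distrib]
  zero_smul F := by
    refine big_ext k Λ fun c y => ?_
    simp [big_smul_apply, big_zero_apply]

/-- `⊕_{c ∈ S} P_c`, as the matrices `F` with `F c y = 0` unless `c ∈ S` and `y ≤ c`. -/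
def QS (S : Set Λ) : Submodule (IncidenceAlgebra k Λᵒᵈ)ᵐᵒᵖ (Big k Λ) where
  carrier := {F | ∀ c y, ¬ (c ∈ S ∧ y ≤ c) → F c y = 0}
  zero_mem' _ _ _ := rfl
  add_mem' {F G} hF hG c y h := by rw [big_add_apply, hF c y h, hG c y h, add_zero]
  smul_mem' g F hF c y h := by
    rw [big_smul_apply]
    refine Finset.sum_eq_zero fun z _ => ?_
    by_cases h1 : c ∈ S ∧ z ≤ c
    · have : ¬ (toDual z ≤ toDual y) := fun h2 => h ⟨h1.1, le_trans (toDual_le_toDual.1 h2) h1.2⟩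
      rw [IncidenceAlgebra.apply_eq_zero_of_not_le this, mul_zero]
    · rw [hF c z h1, zero_mul]

open Classical in
/-- Inclusion of `QS S` in a free module. -/
noncomputable def QSi (S : Set Λ) :
    QS k Λ S →ₗ[(IncidenceAlgebra k Λᵒᵈ)ᵐᵒᵖ] (Λ → (IncidenceAlgebra k Λᵒᵈ)ᵐᵒᵖ) where
  toFun F c := MulOpposite.op ⟨fun x y => if ofDual x = c then F.1 c (ofDual y) else 0, by
    intro x y hxy
    split_ifs with h
    · refine F.2 _ _ fun h2 => hxy ?_
      rw [← h] at h2
      exact h2.2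
    · rfl⟩
  map_add' F G := by
    refine funext fun c => MulOpposite.unop_injective ?_
    ext x y hxy
    change (if ofDual x = c then (F.1 + G.1) c (ofDual y) else 0) =
      (if ofDual x = c then F.1 c (ofDual y) else 0) + (if ofDual x = c then G.1 c (ofDual y) else 0)
    split_ifs
    · rfl
    · simp
  map_smul' g F := by
    refine funext fun c => MulOpposite.unop_injective ?_
    ext x y hxy
    refine Eq.trans ?_ (mul_apply_univ k Λ _ _ (ofDual x) (ofDual y)).symm
    change (if ofDual x = c then (g • F.1) c (ofDual y) else 0) =
      ∑ z : Λ, (if ofDual x = c then F.1 c z else 0) * g.unop (toDual z) y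
    split_ifs
    · rfl
    · simp

open Classical in
/-- Retraction of a free module onto `QS S`. -/
noncomputable def QSs (S : Set Λ) :
    (Λ → (IncidenceAlgebra k Λᵒᵈ)ᵐᵒᵖ) →ₗ[(IncidenceAlgebra k Λᵒᵈ)ᵐᵒᵖ] QS k Λ S where
  toFun X := ⟨fun c y => if c ∈ S then (X c).unop (toDual c) (toDual y) else 0, by
    intro c y h
    beta_reduce
    split_ifs with h1
    · exact IncidenceAlgebra.apply_eq_zero_of_not_le (a := toDual c) (b := toDual y)
        (fun h2 => h ⟨h1, h2⟩) (X c).unop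
    · rfl⟩
  map_add' X Y := by
    refine Subtype.ext (big_ext k Λ fun c y => ?_)
    change (if c ∈ S then (X c).unop (toDual c) (toDual y) + (Y c).unop (toDual c) (toDual y)
      else 0) = (if c ∈ S then (X c).unop (toDual c) (toDual y) else 0) +
        (if c ∈ S then (Y c).unop (toDual c) (toDual y) else 0)
    split_ifs
    · rfl
    · simp
  map_smul' g X := by
    refine Subtype.ext (big_ext k Λ fun c y => ?_)
    change (if c ∈ S then ((X c).unop * g.unop) (toDual c) (toDual y) else 0) =
      ∑ z : Λ, (if c ∈ S then (X c).unop (toDual c) (toDual z) else 0) *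
        g.unop (toDual z) (toDual y)
    split_ifs
    · exact mul_apply_univ ..
    · simp

open Classical in
instance QS_proj (S : Set Λ) : Module.Projective (IncidenceAlgebra k Λᵒᵈ)ᵐᵒᵖ (QS k Λ S) := by
  refine Module.Projective.of_split (QSi k Λ S) (QSs k Λ S) ?_
  refine LinearMap.ext fun F => Subtype.ext (big_ext k Λ fun c y => ?_)
  change (if c ∈ S then (if c = c then F.1 c y else 0) else 0) = F.1 c y
  rw [if_pos rfl]
  split_ifs with h
  · rfl
  · exact (F.2 c y fun h' => h h'.1).symm

theorem simple_smul (l : Λ) (g : (IncidenceAlgebra k Λᵒᵈ)ᵐᵒᵖ) (x : SimpleM k Λ l) :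
    g • x = (g.unop (toDual l) (toDual l) * (show k from x) : k) := rfl

theorem simple_smul_one (l : Λ) (g : (IncidenceAlgebra k Λᵒᵈ)ᵐᵒᵖ) (x : SimpleM k Λ l)
    (h : g.unop (toDual l) (toDual l) = 1) : g • x = x := by
  rw [simple_smul, h]
  exact one_mul (M := k) x

theorem simple_smul_zero (l : Λ) (g : (IncidenceAlgebra k Λᵒᵈ)ᵐᵒᵖ) (x : SimpleM k Λ l)
    (h : g.unop (toDual l) (toDual l) = 0) : g • x = 0 := by
  rw [simple_smul, h]
  exact zero_mul (M₀ := k) x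

/-- The projective cover `P_l → M_l`. -/
def pMap (l : Λ) : QS k Λ {l} →ₗ[(IncidenceAlgebra k Λᵒᵈ)ᵐᵒᵖ] SimpleM k Λ l where
  toFun F := F.1 l l
  map_add' _ _ := rfl
  map_smul' g F := by
    change (∑ z : Λ, F.1 l z * g.unop (toDual z) (toDual l) : k) =
      g.unop (toDual l) (toDual l) * F.1 l l
    rw [Finset.sum_eq_single l, mul_comm]
    · intro z _ hz
      by_cases h : z ≤ l
      · rw [IncidenceAlgebra.apply_eq_zero_of_not_le, mul_zero]
        intro h2
        exact hz (le_antisymm h h2)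
      · rw [F.2 l z (fun h' => h h'.2), zero_mul]
    · simp

/-- The differential `⊕_{c ⋖ l} P_c → P_l`. -/
def dMap (l : Λ) : QS k Λ {c | c ⋖ l} →ₗ[(IncidenceAlgebra k Λᵒᵈ)ᵐᵒᵖ] QS k Λ {l} where
  toFun F := ⟨fun c y => if c = l then ∑ x : Λ, F.1 x y else 0, by
    intro c y h
    beta_reduce
    split_ifs with h1
    · refine Finset.sum_eq_zero fun x _ => F.2 x y fun h2 => h ⟨h1, ?_⟩
      rw [h1]
      exact h2.2.trans h2.1.le
    · rfl⟩
  map_add' F G := by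
    refine Subtype.ext (big_ext k Λ fun c y => ?_)
    change (if c = l then ∑ x : Λ, (F.1 x y + G.1 x y) else 0) =
      (if c = l then ∑ x : Λ, F.1 x y else 0) + (if c = l then ∑ x : Λ, G.1 x y else 0)
    split_ifs
    · exact Finset.sum_add_distrib
    · simp
  map_smul' g F := by
    refine Subtype.ext (big_ext k Λ fun c y => ?_)
    change (if c = l then ∑ x : Λ, ∑ z : Λ, F.1 x z * g.unop (toDual z) (toDual y) else 0) =
      ∑ z : Λ, (if c = l then ∑ x : Λ, F.1 x z else 0) * g.unop (toDual z) (toDual y)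
    split_ifs
    · rw [Finset.sum_comm]
      simp only [Finset.sum_mul]
    · simp

theorem dMap_apply (l : Λ) (F : QS k Λ {c | c ⋖ l}) (y : Λ) :
    (dMap k Λ l F).1 l y = ∑ x : Λ, F.1 x y := if_pos rfl

theorem pMap_surj (l : Λ) : Function.Surjective (pMap k Λ l) := by
  intro x
  let x' : k := x
  refine ⟨⟨fun c y => if c = l ∧ y = l then x' else 0, ?_⟩, ?_⟩
  · intro c y h
    beta_reduce
    rw [if_neg]
    rintro ⟨rfl, rfl⟩
    exact h ⟨rfl, le_rfl⟩
  · exact if_pos ⟨rfl, rfl⟩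

theorem p_comp_d (l : Λ) (F : QS k Λ {c | c ⋖ l}) : pMap k Λ l (dMap k Λ l F) = 0 := by
  change (dMap k Λ l F).1 l l = 0
  rw [dMap_apply]
  exact Finset.sum_eq_zero fun x _ => F.2 x l fun h => absurd h.1.lt (not_lt_of_ge h.2)

theorem exists_cov (l y : Λ) (h : y < l) : ∃ c, c ⋖ l ∧ y ≤ c := by
  obtain ⟨c, h1, h2⟩ := exists_le_covBy_of_lt h
  exact ⟨c, h2, h1⟩

open Classical in
theorem p_exact (l : Λ) (F : QS k Λ {l}) (hF : pMap k Λ l F = 0) :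
    ∃ G, dMap k Λ l G = F := by
  choose ch h1 h2 using exists_cov Λ l
  refine ⟨⟨fun c y => if h : y < l then (if c = ch y h then F.1 l y else 0) else 0, ?_⟩, ?_⟩
  · intro c y h
    beta_reduce
    split_ifs with h3 h4
    · exact absurd ⟨h4 ▸ h1 y h3, h4 ▸ h2 y h3⟩ h
    · rfl
    · rfl
  · refine Subtype.ext (big_ext k Λ fun c y => ?_)
    by_cases hc : c = l
    · subst hc
      rw [dMap_apply]
      by_cases hy : y < c
      · simp [hy]
      · simp only [hy, dite_false, Finset.sum_const_zero]
        by_cases hy2 : y = c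
        · rw [hy2]; exact hF.symm
        · exact (F.2 c y fun h => hy (lt_of_le_of_ne h.2 hy2)).symm
    · exact (if_neg hc).trans (F.2 c y fun h => hc h.1).symm

/-- The element of the algebra with `k`-entries `t` at `(x, x)`. -/
def diagE (x : Λ) (t : k) : (IncidenceAlgebra k Λᵒᵈ)ᵐᵒᵖ :=
  MulOpposite.op ⟨fun y z => if y = toDual x ∧ z = toDual x then t else 0, by
    intro y z h
    rw [if_neg]
    rintro ⟨rfl, rfl⟩
    exact h le_rfl⟩

theorem diagE_apply (x y z : Λ) (t : k) :
    (diagE k Λ x t).unop (toDual y) (toDual z) = if y = x ∧ z = x then t else 0 := rfl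

theorem diagE_smul (x : Λ) (t : k) (F : Big k Λ) (c y : Λ) :
    (diagE k Λ x t • F) c y = if y = x then F c x * t else 0 := by
  rw [big_smul_apply]
  simp only [diagE_apply]
  by_cases h : y = x <;> simp [h]

open Classical in
/-- The sum of all `e_{y x}` with `y > x`. -/
noncomputable def colE (x : Λ) : (IncidenceAlgebra k Λᵒᵈ)ᵐᵒᵖ :=
  MulOpposite.op ⟨fun y z => if z = toDual x ∧ x < ofDual y then 1 else 0, by
    intro y z h
    rw [if_neg]
    rintro ⟨rfl, h2⟩
    exact h h2.le⟩

open Classical in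
theorem colE_apply (x y z : Λ) :
    (colE k Λ x).unop (toDual y) (toDual z) = if z = x ∧ x < y then 1 else 0 := rfl

theorem hom_zero (l l' : Λ) (h : ¬ l' ⋖ l)
    (f : QS k Λ {c | c ⋖ l} →ₗ[(IncidenceAlgebra k Λᵒᵈ)ᵐᵒᵖ] SimpleM k Λ l') : f = 0 := by
  refine LinearMap.ext fun F => ?_
  let F' : QS k Λ {c | c ⋖ l} := ⟨fun c y => if c = y then F.1 c l' else 0, by
    intro c y hc
    beta_reduce
    split_ifs with h1
    · refine F.2 _ _ fun h2 => hc ⟨h2.1, h1.ge⟩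
    · rfl⟩
  have key : diagE k Λ l' 1 • F = colE k Λ l' • F' := by
    refine Subtype.ext (big_ext k Λ fun c y => ?_)
    change (diagE k Λ l' 1 • F.1) c y =
      ∑ z : Λ, (if c = z then F.1 c l' else 0) * (colE k Λ l').unop (toDual z) (toDual y)
    rw [diagE_smul]
    simp only [colE_apply, ite_mul, zero_mul, Finset.sum_ite_eq, Finset.mem_univ, if_true]
    by_cases hy : y = l'
    · by_cases hc : l' < c
      · simp [hy, hc]
      · have : F.1 c l' = 0 := by
          refine F.2 _ _ fun h2 => ?_
          rcases h2.2.eq_or_lt with h3 | h3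
          · exact h (h3 ▸ h2.1)
          · exact hc h3
        simp [this]
    · simp [hy]
  have h1 : f (diagE k Λ l' 1 • F) = f F := by
    rw [map_smul]
    exact simple_smul_one k Λ l' _ _ (by simp [diagE_apply])
  rw [← h1, key, map_smul]
  exact simple_smul_zero k Λ l' _ _ (by simp [colE_apply])

section loop

variable {l l' a b : Λ}

/-- The element `e_{a l'} - e_{b l'}`. -/
def wElt (l' a b : Λ) : Big k Λ :=
  fun c y => if y = l' then (if c = a then 1 else if c = b then -1 else 0) else 0

theorem wElt_mem (hal : a ⋖ l) (hbl : b ⋖ l) (hla : l' ⋖ a) (hlb : l' ⋖ b) :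
    wElt k Λ l' a b ∈ QS k Λ {c | c ⋖ l} := by
  intro c y h
  unfold wElt
  split_ifs with h1 h2 h3
  · subst h1 h2; exact absurd ⟨hal, hla.le⟩ h
  · subst h1 h3; exact absurd ⟨hbl, hlb.le⟩ h
  · rfl
  · rfl

theorem wElt_ker (hab : a ≠ b) (hal : a ⋖ l) (hbl : b ⋖ l) (hla : l' ⋖ a) (hlb : l' ⋖ b) :
    (⟨wElt k Λ l' a b, wElt_mem k Λ hal hbl hla hlb⟩ : QS k Λ {c | c ⋖ l}) ∈
      LinearMap.ker (dMap k Λ l) := by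
  rw [LinearMap.mem_ker]
  refine Subtype.ext (big_ext k Λ fun c y => ?_)
  change (if c = l then ∑ x : Λ, wElt k Λ l' a b x y else 0) = 0
  split_ifs
  · unfold wElt
    split_ifs
    · rw [Fintype.sum_eq_add a b hab]
      · simp [hab.symm]
      · rintro x ⟨h1, h2⟩
        simp [h1, h2]
    · simp
  · rfl

theorem ker_sum (F : LinearMap.ker (dMap k Λ l)) (y : Λ) : ∑ x : Λ, F.1.1 x y = 0 := by
  rw [← dMap_apply, LinearMap.mem_ker.1 F.2]
  rfl

theorem ker_diag (hal : a ⋖ l) (F : LinearMap.ker (dMap k Λ l)) :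
    F.1.1 a a = 0 := by
  have := ker_sum k Λ F a
  rw [Finset.sum_eq_single a] at this
  · exact this
  · intro x _ hx
    refine F.1.2 _ _ fun h => ?_
    exact hal.2 (lt_of_le_of_ne h.2 hx.symm) h.1.lt
  · simp

theorem ker_smul (hab : a ≠ b) (hal : a ⋖ l) (hbl : b ⋖ l) (hla : l' ⋖ a) (hlb : l' ⋖ b)
    (hI : Set.Icc l' l = {l, a, b, l'}) (F : LinearMap.ker (dMap k Λ l)) :
    diagE k Λ l' 1 • F = diagE k Λ l' (F.1.1 a l') •
      (⟨_, wElt_ker k Λ hab hal hbl hla hlb⟩ : LinearMap.ker (dMap k Λ l)) := by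
  have h0 : ∀ x, x ≠ a → x ≠ b → F.1.1 x l' = 0 := by
    intro x hxa hxb
    refine F.1.2 _ _ fun h => ?_
    have : x ∈ Set.Icc l' l := ⟨h.2, h.1.le⟩
    rw [hI] at this
    rcases this with h1 | h1 | h1 | h1
    · exact h.1.ne h1
    · exact hxa h1
    · exact hxb h1
    · rw [Set.mem_singleton_iff] at h1
      subst h1
      exact h.1.2 hla.lt hal.lt
  have h2 : F.1.1 a l' + F.1.1 b l' = 0 := by
    rw [← Fintype.sum_eq_add a b hab (fun x hx => h0 x hx.1 hx.2)]
    exact ker_sum k Λ F l'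
  refine Subtype.ext (Subtype.ext (big_ext k Λ fun c y => ?_))
  change (diagE k Λ l' 1 • F.1.1) c y = (diagE k Λ l' (F.1.1 a l') • wElt k Λ l' a b) c y
  rw [diagE_smul, diagE_smul]
  unfold wElt
  by_cases hc : c = a
  · simp [hc]
  · by_cases hc' : c = b
    · simp [hc', hab.symm, eq_neg_of_add_eq_zero_right h2]
    · simp [hc, hc', h0 c hc hc']

/-- The map `ker d → M_{l'}` with value `t` on `wElt`. -/
def tMap (hal : a ⋖ l) (hla : l' ⋖ a) (t : k) :
    LinearMap.ker (dMap k Λ l) →ₗ[(IncidenceAlgebra k Λᵒᵈ)ᵐᵒᵖ] SimpleM k Λ l' where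
  toFun F := (F.1.1 a l' * t : k)
  map_add' F G := add_mul (F.1.1 a l') (G.1.1 a l') t
  map_smul' g F := by
    change ((∑ z : Λ, F.1.1 a z * g.unop (toDual z) (toDual l')) * t : k) =
      g.unop (toDual l') (toDual l') * (F.1.1 a l' * t)
    rw [Finset.sum_eq_single l']
    · ring
    · intro z _ hz
      by_cases hza : z = a
      · rw [hza, ker_diag k Λ hal F, zero_mul]
      · by_cases h1 : z ≤ a
        · rw [IncidenceAlgebra.apply_eq_zero_of_not_le, mul_zero]
          intro h2
          exact hla.2 (lt_of_le_of_ne h2 (Ne.symm hz)) (lt_of_le_of_ne h1 hza)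
        · rw [F.1.2 a z (fun h' => h1 h'.2), zero_mul]
    · simp

end loop

open ModuleCat in
theorem hom_ker_equiv {R : Type u} [Ring R] [Algebra k R] {P1 P0 N : ModuleCat.{u} R}
    (d : P1 ⟶ P0) (w : LinearMap.ker d.hom) (τ : N →+ k)
    (hτ : ∀ (c : k) (x : N), τ (algebraMap k R c • x) = c * τ x)
    (hτi : Function.Injective τ)
    (hinj : ∀ f : LinearMap.ker d.hom →ₗ[R] N, f w = 0 → f = 0)
    (hsurj : ∀ t : k, ∃ f : LinearMap.ker d.hom →ₗ[R] N, τ (f w) = t) :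
    Nonempty ((Limits.kernel d ⟶ N) ≃ₗ[k] k) := by
  let e := ModuleCat.kernelIsoKer d
  let ev : (Limits.kernel d ⟶ N) →ₗ[k] k :=
    { toFun := fun f => τ ((e.inv ≫ f).hom w)
      map_add' := fun f g => by simp
      map_smul' := fun c f => hτ c ((e.inv ≫ f).hom w) }
  refine ⟨LinearEquiv.ofBijective ev ⟨?_, ?_⟩⟩
  · rw [injective_iff_map_eq_zero]
    intro f hf
    have h1 : (e.inv ≫ f).hom w = 0 := hτi (hf.trans (map_zero τ).symm)
    have h2 : e.inv ≫ f = 0 := ModuleCat.hom_ext (hinj _ h1)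
    rw [← Category.id_comp f, ← e.hom_inv_id, Category.assoc, h2, Limits.comp_zero]
  · intro t
    obtain ⟨f, hf⟩ := hsurj t
    refine ⟨e.hom ≫ ModuleCat.ofHom f, ?_⟩
    change τ ((e.inv ≫ e.hom ≫ ModuleCat.ofHom f).hom w) = t
    rw [e.inv_hom_id_assoc]
    exact hf

/-- Let `k` be a field, `Λ` a finite poset and `A = k[Λ]` its incidence algebra (the
Mathlib incidence algebra of the dual order; right `A`-modules are `Aᵐᵒᵖ`-modules). If
the closed interval `{γ : λ ≥ γ ≥ λ'}` is a simple loop, then `Ext²_A(M_λ, M_λ') ≅ k`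
as `k`-vector spaces. -/
theorem ext_two_of_simpleLoop (l l' : Λ) (h : IsSimpleLoop Λ l l') :
    Nonempty
      ((((Ext k (ModuleCat.{u} (IncidenceAlgebra k Λᵒᵈ)ᵐᵒᵖ) 2).obj
          (Opposite.op (ModuleCat.of _ (SimpleM k Λ l)))).obj
            (ModuleCat.of _ (SimpleM k Λ l'))) ≃ₗ[k] k) := by
  obtain ⟨a, b, hab, hba, hal, hbl, hla, hlb, hI⟩ := h
  have hne : a ≠ b := fun h => hab h.le
  have hnc : ¬ l' ⋖ l := fun h => h.2 hla.lt hal.lt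
  let d : ModuleCat.of (IncidenceAlgebra k Λᵒᵈ)ᵐᵒᵖ (QS k Λ {c | c ⋖ l}) ⟶
    ModuleCat.of (IncidenceAlgebra k Λᵒᵈ)ᵐᵒᵖ (QS k Λ {l}) := ModuleCat.ofHom (dMap k Λ l)
  let p : ModuleCat.of (IncidenceAlgebra k Λᵒᵈ)ᵐᵒᵖ (QS k Λ {l}) ⟶
    ModuleCat.of (IncidenceAlgebra k Λᵒᵈ)ᵐᵒᵖ (SimpleM k Λ l) := ModuleCat.ofHom (pMap k Λ l)
  have hp1 : Projective (ModuleCat.of (IncidenceAlgebra k Λᵒᵈ)ᵐᵒᵖ (QS k Λ {c | c ⋖ l})) :=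
    (IsProjective.iff_projective _).1 (QS_proj k Λ _)
  have hp0 : Projective (ModuleCat.of (IncidenceAlgebra k Λᵒᵈ)ᵐᵒᵖ (QS k Λ {l})) :=
    (IsProjective.iff_projective _).1 (QS_proj k Λ _)
  have hepi : Epi p := (ModuleCat.epi_iff_surjective p).2 (pMap_surj k Λ l)
  have w : d ≫ p = 0 := ModuleCat.hom_ext (LinearMap.ext (p_comp_d k Λ l))
  have ex : (ShortComplex.mk d p w).Exact := by
    rw [ShortComplex.moduleCat_exact_iff]
    exact p_exact k Λ l
  obtain ⟨e⟩ := ext_two_gen (k := k) d p w ex (ModuleCat.of _ (SimpleM k Λ l'))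
    (fun f => ModuleCat.hom_ext (hom_zero k Λ l l' hnc f.hom))
  obtain ⟨e'⟩ := hom_ker_equiv k d (N := ModuleCat.of _ (SimpleM k Λ l'))
    ⟨_, wElt_ker k Λ hne hal hbl hla hlb⟩ (AddMonoidHom.id k)
    (by
      intro c x
      change (c * (1 : IncidenceAlgebra k Λᵒᵈ) (toDual l') (toDual l')) * (show k from x) =
        c * (show k from x)
      simp)
    (fun _ _ h => h)
    (by
      intro f hf
      refine LinearMap.ext fun F => ?_
      have h1 : f (diagE k Λ l' 1 • F) = f F := by
        rw [map_smul]
        exact simple_smul_one k Λ l' _ _ (by simp [diagE_apply])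
      have h2 := ker_smul k Λ hne hal hbl hla hlb hI F
      refine h1.symm.trans ((congrArg f h2).trans ?_)
      refine (map_smul f _ _).trans ?_
      rw [hf, smul_zero]
      rfl)
    (by
      intro t
      refine ⟨tMap k Λ hal hla t, ?_⟩
      change wElt k Λ l' a b a l' * t = t
      simp [wElt])
  exact ⟨e.trans e'⟩
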